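/- arXiv:1903.10232 — 3 statements merged into one kernel-verified Lean document; each statement's English description precedes it below -/
import Mathlib

section
/- The function f(z) = (z − z²/2)/(1 − z)² is analytic on 𝔻 with f(0) = 0 and f'(0) = 1, satisfies 1 + z f''(z)/f'(z) = (1 + 2z)/(1 − z) for all z ∈ 𝔻, and belongs to C(−1/2); that is, f'(z) ≠ 0 and Re(1 + z f''(z)/f'(z)) > −1/2 for all z ∈ 𝔻. -/
open Metric

theorem one_sub_ne_zero_of_mem_ball {z : ℂ} (hz : z ∈ ball (0 : ℂ) 1) : 1 - z ≠ 0 := by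
  intro h
  rw [mem_ball_zero_iff, ← sub_eq_zero.mp h, norm_one] at hz
  exact lt_irrefl _ hz

theorem hasDerivAt_sub_sq_half_div_one_sub_sq {z : ℂ} (hz : 1 - z ≠ 0) :
    HasDerivAt (fun z : ℂ => (z - z ^ 2 / 2) / (1 - z) ^ 2) (1 / (1 - z) ^ 3) z := by
  have hnum : HasDerivAt (fun z : ℂ => z - z ^ 2 / 2) (1 - z) z := by
    refine HasDerivAt.congr_deriv ((hasDerivAt_id' z).fun_sub ((hasDerivAt_pow 2 z).div_const 2)) ?_
    push_cast
    ring
  have hden : HasDerivAt (fun z : ℂ => (1 - z) ^ 2) (-(2 * (1 - z))) z := by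
    refine HasDerivAt.congr_deriv (((hasDerivAt_id' z).const_sub 1).fun_pow 2) ?_
    push_cast
    ring
  refine HasDerivAt.congr_deriv (hnum.fun_div hden (pow_ne_zero 2 hz)) ?_
  field_simp
  ring

theorem hasDerivAt_one_div_one_sub_pow_three {z : ℂ} (hz : 1 - z ≠ 0) :
    HasDerivAt (fun z : ℂ => 1 / (1 - z) ^ 3) (3 / (1 - z) ^ 4) z := by
  have hden : HasDerivAt (fun z : ℂ => (1 - z) ^ 3) (-(3 * (1 - z) ^ 2)) z := by
    refine HasDerivAt.congr_deriv (((hasDerivAt_id' z).const_sub 1).fun_pow 3) ?_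
    push_cast
    ring
  refine HasDerivAt.congr_deriv ((hasDerivAt_const z (1 : ℂ)).fun_div hden (pow_ne_zero 3 hz)) ?_
  field_simp
  ring

theorem neg_half_lt_re_one_add_two_mul_div_one_sub {z : ℂ} (hz : z ∈ ball (0 : ℂ) 1) :
    -(1 / 2 : ℝ) < ((1 + 2 * z) / (1 - z)).re := by
  have hpos : 0 < Complex.normSq (1 - z) :=
    Complex.normSq_pos.mpr (one_sub_ne_zero_of_mem_ball hz)
  have hlt : Complex.normSq z < 1 := by
    rw [Complex.normSq_eq_norm_sq]
    rw [mem_ball_zero_iff] at hz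
    nlinarith [norm_nonneg z]
  rw [Complex.div_re, ← add_div, lt_div_iff₀ hpos]
  simp [Complex.normSq_apply] at hlt ⊢
  nlinarith

/-- The function `f(z) = (z − z²/2)/(1 − z)²` is analytic on `𝔻` with `f(0) = 0`,
`f'(0) = 1`, satisfies `1 + z f''(z)/f'(z) = (1 + 2z)/(1 − z)` on `𝔻`, and belongs
to `C(−1/2)`. -/
theorem example_C_neg_half :
    let f : ℂ → ℂ := fun z => (z - z ^ 2 / 2) / (1 - z) ^ 2
    DifferentiableOn ℂ f (ball (0 : ℂ) 1) ∧
    f 0 = 0 ∧ deriv f 0 = 1 ∧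
    (∀ z ∈ ball (0 : ℂ) 1, deriv f z ≠ 0) ∧
    (∀ z ∈ ball (0 : ℂ) 1,
      1 + z * deriv (deriv f) z / deriv f z = (1 + 2 * z) / (1 - z)) ∧
    (∀ z ∈ ball (0 : ℂ) 1,
      -(1 / 2 : ℝ) < (1 + z * deriv (deriv f) z / deriv f z).re) := by
  intro f
  have hf : ∀ z ∈ ball (0 : ℂ) 1, deriv f z = 1 / (1 - z) ^ 3 := fun z hz =>
    (hasDerivAt_sub_sq_half_div_one_sub_sq (one_sub_ne_zero_of_mem_ball hz)).deriv
  have hf' : ∀ z ∈ ball (0 : ℂ) 1, deriv (deriv f) z = 3 / (1 - z) ^ 4 := fun z hz =>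
    (Filter.EventuallyEq.deriv_eq
      (Filter.eventuallyEq_of_mem (isOpen_ball.mem_nhds hz) hf)).trans
      (hasDerivAt_one_div_one_sub_pow_three (one_sub_ne_zero_of_mem_ball hz)).deriv
  have hq : ∀ z ∈ ball (0 : ℂ) 1,
      1 + z * deriv (deriv f) z / deriv f z = (1 + 2 * z) / (1 - z) := by
    intro z hz
    have h := one_sub_ne_zero_of_mem_ball hz
    rw [hf z hz, hf' z hz]
    field_simp
    ring
  refine ⟨fun z hz => ?_, by simp [f], ?_, fun z hz => ?_, hq, fun z hz => ?_⟩
  · exact (hasDerivAt_sub_sq_half_div_one_sub_sq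
      (one_sub_ne_zero_of_mem_ball hz)).differentiableAt.differentiableWithinAt
  · simp [hf 0 (mem_ball_self one_pos)]
  · rw [hf z hz]
    exact one_div_ne_zero (pow_ne_zero 3 (one_sub_ne_zero_of_mem_ball hz))
  · rw [hq z hz]
    exact neg_half_lt_re_one_add_two_mul_div_one_sub hz
end

section
/- The function f(z) = (z − z²/2)/(1 − z)² is not starlike in 𝔻: there exists z ∈ 𝔻 with z ≠ 0 and f(z) ≠ 0 such that Re(z f'(z)/f(z)) ≤ 0. -/
open Metric

/-- The function `f(z) = (z − z²/2)/(1 − z)²` is not starlike in `𝔻`: there is a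
point `z ∈ 𝔻`, `z ≠ 0`, `f(z) ≠ 0`, where `Re(z f'(z)/f(z)) ≤ 0`. -/
theorem example_not_starlike :
    let f : ℂ → ℂ := fun z => (z - z ^ 2 / 2) / (1 - z) ^ 2
    ∃ z ∈ ball (0 : ℂ) 1, z ≠ 0 ∧ f z ≠ 0 ∧ (z * deriv f z / f z).re ≤ 0 := by
  intro f
  obtain ⟨z, hz⟩ : ∃ z : ℂ, z = ⟨3 / 4, 5 / 8⟩ := ⟨_, rfl⟩
  have h0 : z ≠ 0 := fun h => by
    have := congrArg Complex.re h
    norm_num [hz] at this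
  have h1 : 1 - z ≠ 0 := fun h => by
    have := congrArg Complex.re h
    norm_num [hz] at this
  have h2 : 2 - z ≠ 0 := fun h => by
    have := congrArg Complex.re h
    norm_num [hz] at this
  have hf : f z = z * (2 - z) / (2 * (1 - z) ^ 2) := by
    simp only [f]
    field_simp
  have hquot : z * deriv f z / f z = 2 / ((1 - z) * (2 - z)) := by
    rw [hf, (hasDerivAt_sub_sq_half_div_one_sub_sq h1).deriv]
    field_simp
  refine ⟨z, ?_, h0, ?_, ?_⟩
  · rw [mem_ball_zero_iff, ← sq_lt_one_iff₀ (norm_nonneg z), Complex.sq_norm,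
      Complex.normSq_apply, hz]
    norm_num
  · rw [hf]
    exact div_ne_zero (mul_ne_zero h0 h2) (mul_ne_zero two_ne_zero (pow_ne_zero 2 h1))
  · rw [hquot, hz, Complex.div_re]
    norm_num [Complex.normSq_apply]
end

section
/- The function f(z) = (z − z²/2)/(1 − z)² has Taylor expansion f(z) = ∑_{n=1}^∞ ((n+1)/2)·zⁿ on 𝔻; consequently its Taylor coefficients a_n = (n+1)/2 satisfy |a_{n+1}| − |a_n| = 1/2 for all n ≥ 1, and n|a_n| − m|a_m| = (n − m)(n + m + 1)/2 for all integers n > m ≥ 1 (so equality holds in the bound |n|a_n| − m|a_m|| ≤ (n − m)(n + m + 1)/2). -/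
open Metric

/-- The function `f(z) = (z − z²/2)/(1 − z)²` has Taylor expansion
`∑_{n≥1} ((n+1)/2) zⁿ` on `𝔻`; its coefficients `a_n = (n+1)/2` satisfy
`|a_{n+1}| − |a_n| = 1/2` for `n ≥ 1` and
`n|a_n| − m|a_m| = (n − m)(n + m + 1)/2` for `n > m ≥ 1`. -/
theorem example_extremal_coefficients :
    let f : ℂ → ℂ := fun z => (z - z ^ 2 / 2) / (1 - z) ^ 2
    let a : ℕ → ℝ := fun n => ((n : ℝ) + 1) / 2
    (∀ z ∈ ball (0 : ℂ) 1,
      HasSum (fun n : ℕ => (((n : ℂ) + 2) / 2) * z ^ (n + 1)) (f z)) ∧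
    (∀ n : ℕ, 1 ≤ n → |a (n + 1)| - |a n| = 1 / 2) ∧
    (∀ m n : ℕ, 1 ≤ m → m < n →
      (n : ℝ) * |a n| - (m : ℝ) * |a m| =
        ((n : ℝ) - (m : ℝ)) * ((n : ℝ) + (m : ℝ) + 1) / 2) := by
  intro f a
  have abs_a (n : ℕ) : |a n| = ((n : ℝ) + 1) / 2 := abs_of_nonneg (by positivity)
  refine ⟨fun z hz => ?_, fun n _ => ?_, fun m n _ _ => ?_⟩
  · have hz : ‖z‖ < 1 := mem_ball_zero_iff.mp hz
    have hne : 1 - z ≠ 0 := by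
      rw [sub_ne_zero]
      rintro rfl
      simp at hz
    have hf : f z = z / 2 * (z / (1 - z) ^ 2) + z * (1 - z)⁻¹ := by
      simp only [f]
      field_simp
      ring
    rw [hf]
    refine (((hasSum_coe_mul_geometric_of_norm_lt_one hz).mul_left (z / 2)).add
      ((hasSum_geometric_of_norm_lt_one hz).mul_left z)).congr_fun fun n => ?_
    ring
  · rw [abs_a, abs_a]
    push_cast
    ring
  · rw [abs_a, abs_a]
    ring
end
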